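/- arXiv:math/0005227 — 4 statements merged into one kernel-verified Lean document; each statement's English description precedes it below -/
import Mathlib

section
/- Let A be a (possibly non-unital) C*-algebra and P its Pedersen ideal. Then an element a ∈ P is a positive element of A (i.e. 0 ≤ a in the canonical order of the C*-algebra A) if and only if a is self-adjoint and ω(a) is a nonnegative real number for every ℂ-linear functional ω : P → ℂ such that ω(star b * b) is a nonnegative real number for all b ∈ P. -/
open scoped ComplexInnerProductSpace ComplexOrder

/-- A *-representation of a (possibly non-unital) *-algebra `A` over `ℂ` on a complex
inner product space (pre-Hilbert space, not assumed complete). -/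
structure StarRep (A : Type) [NonUnitalRing A] [Module ℂ A] [Star A] : Type 1 where
  carrier : Type
  [nacg : NormedAddCommGroup carrier]
  [ips : InnerProductSpace ℂ carrier]
  toFun : A → carrier →ₗ[ℂ] carrier
  map_add' : ∀ a b : A, toFun (a + b) = toFun a + toFun b
  map_smul' : ∀ (c : ℂ) (a : A), toFun (c • a) = c • toFun a
  map_mul' : ∀ a b : A, toFun (a * b) = toFun a ∘ₗ toFun b
  star_rep' : ∀ (a : A) (x y : carrier), ⟪toFun a x, y⟫ = ⟪x, toFun (star a) y⟫

attribute [instance] StarRep.nacg StarRep.ips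

open Filter Topology

section NormEstimates

variable {A : Type*} [NonUnitalCStarAlgebra A] [PartialOrder A] [StarOrderedRing A]

lemma norm_mul_le_norm_mul_of_star_mul_self_le {x s : A} (h : star x * x ≤ star s * s) (b : A) :
    ‖x * b‖ ≤ ‖s * b‖ := by
  have h1 := star_left_conjugate_le_conjugate h b
  have h2 : star (x * b) * (x * b) ≤ star (s * b) * (s * b) := by
    simpa only [star_mul, mul_assoc] using h1
  have h3 := CStarAlgebra.norm_le_norm_of_nonneg_of_le (star_mul_self_nonneg (x * b)) h2
  rw [CStarRing.norm_star_mul_self, CStarRing.norm_star_mul_self] at h3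
  nlinarith [norm_nonneg (x * b), norm_nonneg (s * b)]

lemma norm_mul_le_norm_mul_of_mul_star_self_le {w s : A} (h : w * star w ≤ s * star s) (b : A) :
    ‖b * w‖ ≤ ‖b * s‖ := by
  have := norm_mul_le_norm_mul_of_star_mul_self_le (x := star w) (s := star s)
    (by simpa only [star_star] using h) (star b)
  rwa [← star_mul, ← star_mul, norm_star, norm_star] at this

lemma norm_sub_mul_le_norm_sub_mul {x s : A} (h : star x * x ≤ star s * s) (k : A) :
    ‖x - x * k‖ ≤ ‖s - s * k‖ := by
  set q := CFC.sqrt (star s * s - star x * x) with hq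
  have hqq : star q * q = star s * s - star x * x := by
    rw [(CFC.sqrt_nonneg _).isSelfAdjoint.star_eq]
    exact CFC.sqrt_mul_sqrt_self _ (sub_nonneg.mpr h)
  have h2 : star (x - x * k) * (x - x * k) ≤ star (s - s * k) * (s - s * k) := by
    rw [← sub_nonneg]
    have h3 : star (s - s * k) * (s - s * k) - star (x - x * k) * (x - x * k)
        = star (q - q * k) * (q - q * k) := by
      have expand : ∀ y : A, star (y - y * k) * (y - y * k)
          = star y * y - (star y * y) * k - star k * (star y * y)
            + star k * (star y * y) * k := by
        intro y
        simp only [star_sub, star_mul]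
        noncomm_ring
      rw [expand, expand, expand, hqq]
      noncomm_ring
    rw [h3]
    exact star_mul_self_nonneg _
  have h3 := CStarAlgebra.norm_le_norm_of_nonneg_of_le (star_mul_self_nonneg _) h2
  rw [CStarRing.norm_star_mul_self, CStarRing.norm_star_mul_self] at h3
  nlinarith [norm_nonneg (x - x * k), norm_nonneg (s - s * k)]

lemma exists_seq_tendsto_mul_mul_self {s : A} (hs : 0 ≤ s) :
    ∃ g : ℕ → A, (∀ n, IsSelfAdjoint (g n)) ∧
      Tendsto (fun n => s * g n * s) atTop (𝓝 s) := by
  let f : ℕ → ℝ → ℝ := fun n t => t / (t ^ 2 + (1 / ((n : ℝ) + 1)) ^ 2)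
  have hpos : ∀ (n : ℕ) (t : ℝ), 0 < t ^ 2 + (1 / ((n : ℝ) + 1)) ^ 2 := fun n t => by positivity
  have hf : ∀ n, Continuous (f n) := fun n =>
    continuous_id.div (by fun_prop) (fun t => (hpos n t).ne')
  have hf0 : ∀ n, f n 0 = 0 := fun n => by simp [f]
  refine ⟨fun n => cfcₙ (f n) s, fun n => cfcₙ_predicate _ _, ?_⟩
  rw [tendsto_iff_norm_sub_tendsto_zero]
  refine squeeze_zero (fun _ => norm_nonneg _) (fun n => ?_)
    tendsto_one_div_add_atTop_nhds_zero_nat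
  have hid : cfcₙ (fun t : ℝ => t) s = s := cfcₙ_id' ℝ s
  have hfn := (hf n).continuousOn (s := quasispectrum ℝ s)
  have h1 : cfcₙ (fun t : ℝ => t * f n t * t - t) s = s * cfcₙ (f n) s * s - s := by
    rw [cfcₙ_sub (fun t : ℝ => t * f n t * t) (fun t => t) s (by fun_prop) (by simp)
        (by fun_prop) (by simp),
      cfcₙ_mul (fun t : ℝ => t * f n t) (fun t => t) s (by fun_prop) (by simp)
        (by fun_prop) (by simp),
      cfcₙ_mul (fun t : ℝ => t) (f n) s (by fun_prop) (by simp) (by fun_prop) (hf0 n), hid]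
  rw [← h1]
  refine norm_cfcₙ_le fun t _ => ?_
  have hd : 0 < 1 / ((n : ℝ) + 1) := by positivity
  have hp := hpos n t
  simp only [f]
  generalize 1 / ((n : ℝ) + 1) = d at *
  have h2 : t * (t / (t ^ 2 + d ^ 2)) * t - t = - (t * d ^ 2 / (t ^ 2 + d ^ 2)) := by
    field_simp
    ring
  rw [h2, norm_neg, Real.norm_eq_abs, abs_div, abs_of_pos hp, div_le_iff₀ hp, abs_mul,
    abs_of_pos (pow_pos hd 2)]
  nlinarith [sq_nonneg (|t| - d), sq_abs t, abs_nonneg t, mul_nonneg hd.le (sq_nonneg (|t| - d)),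
    mul_nonneg (mul_nonneg hd.le hd.le) (abs_nonneg t), mul_nonneg hd.le (sq_nonneg t), pow_pos hd 3]

/-- A Riesz decomposition property: an element dominated by a finite sum of squares is itself a
finite sum of squares, whose terms inherit the right multipliers fixing the original ones. -/
lemma exists_eq_sum_mul_star_of_le {a : A} (ha : 0 ≤ a) (l : List A)
    (hal : a ≤ (l.map fun w => w * star w).sum) :
    ∃ u : A → A, a = (l.map fun w => u w * star (u w)).sum ∧
      ∀ w ∈ l, ∀ e, w * e = w → u w * e = u w := by
  set c := (l.map fun w => w * star w).sum with hc
  have hc0 : 0 ≤ c := ha.trans hal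
  set x := CFC.sqrt a
  set s := CFC.sqrt c
  have hx : star x = x := (CFC.sqrt_nonneg a).isSelfAdjoint.star_eq
  have hs : star s = s := (CFC.sqrt_nonneg c).isSelfAdjoint.star_eq
  have hxx : x * x = a := CFC.sqrt_mul_sqrt_self a ha
  have hss : s * s = c := CFC.sqrt_mul_sqrt_self c hc0
  have hxs : star x * x ≤ star s * s := by rwa [hx, hs, hxx, hss]
  obtain ⟨g, hg, hlim⟩ := exists_seq_tendsto_mul_mul_self (CFC.sqrt_nonneg c)
  have hle : ∀ w ∈ l, w * star w ≤ s * star s := by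
    intro w hw
    rw [hs, hss]
    refine List.single_le_sum (l := l.map fun w => w * star w) ?_ _ (List.mem_map_of_mem hw)
    intro y hy
    obtain ⟨v, -, rfl⟩ := List.mem_map.mp hy
    exact mul_star_self_nonneg v
  have hcauchy : ∀ w ∈ l, CauchySeq fun n => x * g n * w := by
    intro w hw
    have h0 := hlim.cauchySeq
    rw [Metric.cauchySeq_iff] at h0 ⊢
    intro ε hε
    obtain ⟨N, hN⟩ := h0 ε hε
    refine ⟨N, fun m hm n hn => lt_of_le_of_lt ?_ (hN m hm n hn)⟩
    rw [dist_eq_norm, dist_eq_norm, ← sub_mul, ← mul_sub, ← sub_mul, ← mul_sub]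
    refine (norm_mul_le_norm_mul_of_mul_star_self_le (hle w hw) _).trans ?_
    rw [mul_assoc, mul_assoc]
    exact norm_mul_le_norm_mul_of_star_mul_self_le hxs _
  have hconv : ∀ w, ∃ y, w ∈ l → Tendsto (fun n => x * g n * w) atTop (𝓝 y) := by
    intro w
    by_cases hw : w ∈ l
    · obtain ⟨y, hy⟩ := cauchySeq_tendsto_of_complete (hcauchy w hw)
      exact ⟨y, fun _ => hy⟩
    · exact ⟨0, fun h => absurd h hw⟩
  choose u hu using hconv
  refine ⟨u, ?_, fun w hw e he => ?_⟩
  · have hxk : Tendsto (fun n => x * (g n * s)) atTop (𝓝 x) := by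
      rw [tendsto_iff_norm_sub_tendsto_zero] at hlim ⊢
      refine squeeze_zero (fun _ => norm_nonneg _) (fun n => ?_) hlim
      rw [norm_sub_rev, norm_sub_rev _ s, mul_assoc]
      exact norm_sub_mul_le_norm_sub_mul hxs _
    have h1 : Tendsto (fun n => (x * (g n * s)) * star (x * (g n * s))) atTop (𝓝 a) := by
      have := hxk.mul hxk.star
      rwa [hx, hxx] at this
    have h2 : Tendsto (fun n => (l.map fun w => (x * g n * w) * star (x * g n * w)).sum) atTop
        (𝓝 (l.map fun w => u w * star (u w)).sum) :=
      tendsto_list_sum l fun w hw => (hu w hw).mul (hu w hw).star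
    refine tendsto_nhds_unique h1 (h2.congr fun n => ?_)
    have h3 : (fun w => (x * g n * w) * star (x * g n * w))
        = fun w => (x * g n) * (w * star w) * star (x * g n) := by
      funext w
      simp only [star_mul, mul_assoc]
    rw [h3, List.sum_map_mul_right, List.sum_map_mul_left, ← hc, ← hss]
    simp only [star_mul, hs, mul_assoc]
  · refine tendsto_nhds_unique ((hu w hw).mul_const e) ((hu w hw).congr fun n => ?_)
    rw [mul_assoc _ w e, he]

end NormEstimates

section LocalUnits

variable {A : Type*} [NonUnitalCStarAlgebra A]

/-- The elements of `A` that are fixed by right multiplication with some element of `P`. -/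
def rightLocalUnitSet (P : Set A) : Set A := {w | ∃ e ∈ P, w * e = w}

lemma mul_mem_rightLocalUnitSet {P : Set A} {w : A} (hw : w ∈ rightLocalUnitSet P) (b : A) :
    b * w ∈ rightLocalUnitSet P := by
  obtain ⟨e, he, hwe⟩ := hw
  exact ⟨e, he, by rw [mul_assoc, hwe]⟩

/-- The two-sided ideal of finite sums of products `w * star v`, where `w` and `v` both have a
right local unit in `P`. -/
def localUnitIdeal (P : Set A) : TwoSidedIdeal A :=
  TwoSidedIdeal.mk'
    (AddSubgroup.closure
      {x | ∃ w ∈ rightLocalUnitSet P, ∃ v ∈ rightLocalUnitSet P, x = w * star v} : Set A)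
    (zero_mem _) (fun hx hy => add_mem hx hy) (fun hx => neg_mem hx)
    (by
      intro b y hy
      refine AddSubgroup.closure_induction (p := fun y _ => b * y ∈ AddSubgroup.closure _)
        ?_ ?_ ?_ ?_ hy
      · rintro _ ⟨w, hw, v, hv, rfl⟩
        exact AddSubgroup.subset_closure
          ⟨b * w, mul_mem_rightLocalUnitSet hw b, v, hv, (mul_assoc _ _ _).symm⟩
      · simp
      · intro x y _ _ hx hy
        rw [mul_add]
        exact add_mem hx hy
      · intro x _ hx
        rw [mul_neg]
        exact neg_mem hx)
    (by
      intro y b hy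
      refine AddSubgroup.closure_induction (p := fun y _ => y * b ∈ AddSubgroup.closure _)
        ?_ ?_ ?_ ?_ hy
      · rintro _ ⟨w, hw, v, hv, rfl⟩
        exact AddSubgroup.subset_closure
          ⟨w, hw, star b * v, mul_mem_rightLocalUnitSet hv _, by simp [mul_assoc]⟩
      · simp
      · intro x y _ _ hx hy
        rw [add_mul]
        exact add_mem hx hy
      · intro x _ hx
        rw [neg_mul]
        exact neg_mem hx)

lemma mem_localUnitIdeal {P : Set A} {x : A} :
    x ∈ localUnitIdeal P ↔ x ∈ AddSubgroup.closure
      {x | ∃ w ∈ rightLocalUnitSet P, ∃ v ∈ rightLocalUnitSet P, x = w * star v} :=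
  TwoSidedIdeal.mem_mk' ..

variable [PartialOrder A] [StarOrderedRing A]

lemma exists_mul_mul_near {x : A} (hx : 0 ≤ x) {δ : ℝ} (hδ : 0 < δ) :
    ∃ f m : A, IsSelfAdjoint f ∧ f * (x * m) = f ∧
      ‖x - f * f * x - x * (f * f) + f * f * x * (f * f)‖ ≤ 4 * δ := by
  let φ : ℝ → ℝ := fun t => max (t - δ) 0 / max t δ
  let μ : ℝ → ℝ := fun t => t / max t δ ^ 2
  have hpos : ∀ t : ℝ, 0 < max t δ := fun t => lt_max_of_lt_right hδ
  have hφ : Continuous φ := Continuous.div (by fun_prop) (by fun_prop) (fun t => (hpos t).ne')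
  have hμ : Continuous μ :=
    Continuous.div (by fun_prop) (by fun_prop) (fun t => (pow_pos (hpos t) 2).ne')
  have hφ0 : φ 0 = 0 := by simp [φ, hδ.le]
  have hμ0 : μ 0 = 0 := by simp [μ]
  have hφc := hφ.continuousOn (s := quasispectrum ℝ x)
  have hμc := hμ.continuousOn (s := quasispectrum ℝ x)
  have hid : cfcₙ (fun t : ℝ => t) x = x := cfcₙ_id' ℝ x
  refine ⟨cfcₙ φ x, cfcₙ μ x, cfcₙ_predicate _ _, ?_, ?_⟩
  · have h1 : cfcₙ (fun t => φ t * (t * μ t)) x = cfcₙ φ x * (x * cfcₙ μ x) := by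
      rw [cfcₙ_mul φ (fun t => t * μ t) x hφc hφ0 (by fun_prop) (by simp),
        cfcₙ_mul (fun t => t) μ x (by fun_prop) (by simp) hμc hμ0, hid]
    rw [← h1]
    congr 1
    funext t
    simp only [φ, μ]
    rcases le_total t δ with h | h
    · simp [max_eq_right (sub_nonpos.mpr h)]
    · have : t ≠ 0 := (hδ.trans_le h).ne'
      rw [max_eq_left h]
      field_simp
  · have hff : cfcₙ (fun t => φ t * φ t) x = cfcₙ φ x * cfcₙ φ x :=
      cfcₙ_mul φ φ x hφc hφ0 hφc hφ0
    have h1 : cfcₙ (fun t => t - φ t * φ t * t - t * (φ t * φ t) + φ t * φ t * t * (φ t * φ t)) x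
        = x - cfcₙ φ x * cfcₙ φ x * x - x * (cfcₙ φ x * cfcₙ φ x)
          + cfcₙ φ x * cfcₙ φ x * x * (cfcₙ φ x * cfcₙ φ x) := by
      rw [cfcₙ_add (fun t => t - φ t * φ t * t - t * (φ t * φ t))
          (fun t => φ t * φ t * t * (φ t * φ t)) x (by fun_prop) (by simp) (by fun_prop) (by simp),
        cfcₙ_sub (fun t => t - φ t * φ t * t) (fun t => t * (φ t * φ t)) x
          (by fun_prop) (by simp) (by fun_prop) (by simp),
        cfcₙ_sub (fun t => t) (fun t => φ t * φ t * t) x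
          (by fun_prop) (by simp) (by fun_prop) (by simp),
        cfcₙ_mul (fun t => φ t * φ t * t) (fun t => φ t * φ t) x
          (by fun_prop) (by simp) (by fun_prop) (by simp [hφ0]),
        cfcₙ_mul (fun t => φ t * φ t) (fun t => t) x
          (by fun_prop) (by simp [hφ0]) (by fun_prop) (by simp),
        cfcₙ_mul (fun t => t) (fun t => φ t * φ t) x
          (by fun_prop) (by simp) (by fun_prop) (by simp [hφ0]), hff, hid]
    rw [← h1]
    refine norm_cfcₙ_le fun t ht => ?_
    have ht0 : 0 ≤ t := quasispectrum_nonneg_of_nonneg x hx t ht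
    have h2 : t - φ t * φ t * t - t * (φ t * φ t) + φ t * φ t * t * (φ t * φ t)
        = t * (1 - φ t * φ t) ^ 2 := by ring
    rw [h2, Real.norm_eq_abs, abs_of_nonneg (by positivity)]
    simp only [φ]
    rcases le_total t δ with h | h
    · rw [max_eq_right (sub_nonpos.mpr h)]
      simp only [zero_div, mul_zero, sub_zero, one_pow, mul_one]
      linarith
    · have htp : 0 < t := hδ.trans_le h
      rw [max_eq_left h, max_eq_left (sub_nonneg.mpr h)]
      have h3 : t * (1 - (t - δ) / t * ((t - δ) / t)) ^ 2 = δ ^ 2 * (2 - δ / t) ^ 2 / t := by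
        field_simp
        ring
      have h4 : δ / t ≤ 1 := (div_le_one htp).mpr h
      have h5 : 0 ≤ δ / t := by positivity
      rw [h3, div_le_iff₀ htp]
      have h6 : (2 - δ / t) ^ 2 ≤ 4 := by nlinarith
      nlinarith [mul_le_mul_of_nonneg_left h6 (sq_nonneg δ), mul_le_mul_of_nonneg_left h hδ.le]

lemma dense_localUnitIdeal {P : Set A} (hmul : ∀ p ∈ P, ∀ b, p * b ∈ P) (hP : Dense P) :
    Dense (localUnitIdeal P : Set A) := by
  have hsub : P ⊆ closure (localUnitIdeal P : Set A) := by
    intro p hp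
    rw [Metric.mem_closure_iff]
    intro ε hε
    obtain ⟨f, m, hf, hfm, hle⟩ := exists_mul_mul_near (mul_star_self_nonneg p)
      (δ := ε ^ 2 / 8) (by positivity)
    have hfD : f ∈ rightLocalUnitSet P := ⟨_, by rw [mul_assoc]; exact hmul p hp _, hfm⟩
    refine ⟨f * f * p, ?_, ?_⟩
    · refine mem_localUnitIdeal.mpr (AddSubgroup.subset_closure
        ⟨f, hfD, star p * f, mul_mem_rightLocalUnitSet hfD _, ?_⟩)
      rw [star_mul, star_star, hf.star_eq, mul_assoc]
    · rw [dist_eq_norm]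
      have h1 : (p - f * f * p) * star (p - f * f * p) = p * star p - f * f * (p * star p)
          - (p * star p) * (f * f) + f * f * (p * star p) * (f * f) := by
        simp only [star_sub, star_mul, hf.star_eq]
        noncomm_ring
      have h2 := CStarRing.norm_self_mul_star (x := p - f * f * p)
      rw [h1] at h2
      rw [h2] at hle
      nlinarith [norm_nonneg (p - f * f * p)]
  rw [dense_iff_closure_eq, Set.eq_univ_iff_forall]
  intro x
  exact closure_minimal hsub isClosed_closure (hP x)

lemma exists_le_sum_of_mem_localUnitIdeal {P : Set A} {b : A} (hb : b ∈ localUnitIdeal P) :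
    ∃ l : List A, (∀ w ∈ l, w ∈ rightLocalUnitSet P) ∧
      b + star b ≤ (l.map fun w => w * star w).sum ∧
      -(b + star b) ≤ (l.map fun w => w * star w).sum := by
  refine AddSubgroup.closure_induction (p := fun b _ => ∃ l : List A,
      (∀ w ∈ l, w ∈ rightLocalUnitSet P) ∧ b + star b ≤ (l.map fun w => w * star w).sum ∧
      -(b + star b) ≤ (l.map fun w => w * star w).sum) ?_ ?_ ?_ ?_ (mem_localUnitIdeal.mp hb)
  · rintro _ ⟨w, hw, v, hv, rfl⟩
    refine ⟨[w, v], by simp [hw, hv], ?_, ?_⟩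
    · rw [← sub_nonneg]
      convert mul_star_self_nonneg (w - v) using 1
      simp only [List.map_cons, List.map_nil, List.sum_cons, List.sum_nil, star_sub, star_mul,
        star_star]
      noncomm_ring
    · rw [← sub_nonneg]
      convert mul_star_self_nonneg (w + v) using 1
      simp only [List.map_cons, List.map_nil, List.sum_cons, List.sum_nil, star_add, star_mul,
        star_star]
      noncomm_ring
  · exact ⟨[], by simp, by simp, by simp⟩
  · rintro x y - - ⟨l, hl, h1, h2⟩ ⟨l', hl', h1', h2'⟩
    refine ⟨l ++ l', fun w hw => (List.mem_append.mp hw).elim (hl w) (hl' w), ?_, ?_⟩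
    · rw [List.map_append, List.sum_append, star_add, add_add_add_comm]
      exact add_le_add h1 h1'
    · rw [List.map_append, List.sum_append, star_add, add_add_add_comm, neg_add]
      exact add_le_add h2 h2'
  · rintro x - ⟨l, hl, h1, h2⟩
    refine ⟨l, hl, ?_, ?_⟩
    · rwa [star_neg, ← neg_add]
    · rwa [star_neg, ← neg_add, neg_neg]

end LocalUnits

section PositiveFunctionals

variable {A : Type*} [NonUnitalCStarAlgebra A] [PartialOrder A] [StarOrderedRing A]

lemma exists_eq_sum_mul_star_of_mem_localUnitIdeal {P : NonUnitalStarSubalgebra ℂ A}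
    (hP : ∀ p ∈ P, ∀ b : A, b * p ∈ P) {a : A} (ha : 0 ≤ a)
    (haI : a ∈ localUnitIdeal (P : Set A)) :
    ∃ l : List P, a = (l.map fun w : P => (w : A) * star (w : A)).sum := by
  obtain ⟨l, hl, hle, -⟩ := exists_le_sum_of_mem_localUnitIdeal haI
  rw [ha.isSelfAdjoint.star_eq] at hle
  obtain ⟨u, hau, hu⟩ := exists_eq_sum_mul_star_of_le ha l
    ((le_add_of_nonneg_left ha).trans hle)
  have huP : ∀ w ∈ l, u w ∈ P := by
    intro w hw
    obtain ⟨e, he, hwe⟩ := hl w hw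
    rw [← hu w hw e hwe]
    exact hP e he _
  refine ⟨l.attach.map fun w : {w // w ∈ l} => (⟨u w.1, huP w.1 w.2⟩ : P), hau.trans ?_⟩
  rw [List.map_map]
  conv_lhs => rw [← List.attach_map_subtype_val l, List.map_map]
  rfl

/-- A self-adjoint element on which every positive functional is nonnegative is itself
nonnegative. -/
lemma exists_positive_functional_of_not_nonneg {a : A} (ha : IsSelfAdjoint a) (hna : ¬ 0 ≤ a) :
    ∃ ω : A →ₗ[ℂ] ℂ, (∀ b : A, 0 ≤ ω (star b * b)) ∧ ¬ 0 ≤ ω a := by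
  let C : ProperCone ℝ A :=
    { carrier := {x | 0 ≤ x}
      add_mem' := fun hx hy => add_nonneg (α := A) hx hy
      zero_mem' := le_refl (0 : A)
      smul_mem' := fun c x hx => smul_nonneg c.2 (show (0 : A) ≤ x from hx)
      isClosed' := CStarAlgebra.isClosed_nonneg }
  obtain ⟨f, hf, hfa⟩ := ProperCone.hyperplane_separation_point C (x₀ := a) hna
  let ω : A →ₗ[ℂ] ℂ :=
    { toFun := fun b => f (realPart b : A) + Complex.I * f (imaginaryPart b : A)
      map_add' := fun x y => by
        simp only [map_add, AddSubgroup.coe_add, Complex.ofReal_add]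
        ring
      map_smul' := fun z x => by
        simp only [realPart_smul, imaginaryPart_smul, AddSubgroup.coe_add, AddSubgroupClass.coe_sub,
          selfAdjoint.val_smul, map_add, map_sub, map_smul, smul_eq_mul, RingHom.id_apply]
        apply Complex.ext <;> simp }
  have hω : ∀ b : A, IsSelfAdjoint b → ω b = f b := fun b hb => by
    simp [ω, hb.coe_realPart, hb.imaginaryPart]
  refine ⟨ω, fun b => ?_, ?_⟩
  · rw [hω _ (IsSelfAdjoint.star_mul_self b), Complex.zero_le_real]
    exact hf _ (star_mul_self_nonneg b)
  · rw [hω a ha, Complex.zero_le_real]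
    exact not_le.mpr hfa

end PositiveFunctionals

/-- Let `A` be a (possibly non-unital) C*-algebra (with its canonical
partial order) and `P` its Pedersen ideal, encoded as a star-closed two-sided ideal which is
dense and contained in every dense two-sided ideal.  Then `a ∈ P` is positive in `A` iff `a`
is self-adjoint and `ω a` is a nonnegative real for every positive `ℂ`-linear functional
`ω : P → ℂ`. -/
theorem stmt0 {A : Type} [NonUnitalCStarAlgebra A] [PartialOrder A] [StarOrderedRing A]
    (P : NonUnitalStarSubalgebra ℂ A)
    (hPideal : ∀ a ∈ P, ∀ b : A, a * b ∈ P ∧ b * a ∈ P)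
    (hPdense : Dense (P : Set A))
    (hPmin : ∀ I : TwoSidedIdeal A, Dense (I : Set A) → (P : Set A) ⊆ (I : Set A))
    (a : P) :
    0 ≤ (a : A) ↔
      (IsSelfAdjoint (a : A) ∧
        ∀ ω : P →ₗ[ℂ] ℂ, (∀ b : P, 0 ≤ ω (star b * b)) → 0 ≤ ω a) := by
  constructor
  · intro ha
    refine ⟨ha.isSelfAdjoint, fun ω hω => ?_⟩
    have hI : (a : A) ∈ localUnitIdeal (P : Set A) :=
      hPmin _ (dense_localUnitIdeal (fun p hp b => (hPideal p hp b).1) hPdense) a.2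
    obtain ⟨l, hl⟩ := exists_eq_sum_mul_star_of_mem_localUnitIdeal
      (fun p hp b => (hPideal p hp b).2) ha hI
    have ha_eq : a = (l.map fun w => w * star w).sum := by
      apply Subtype.ext
      rw [hl, ← NonUnitalStarSubalgebraClass.coe_subtype P, map_list_sum, List.map_map]
      rfl
    rw [ha_eq, map_list_sum, List.map_map]
    refine List.sum_nonneg fun x hx => ?_
    obtain ⟨w, -, rfl⟩ := List.mem_map.mp hx
    simpa using hω (star w)
  · rintro ⟨ha, h⟩
    by_contra hna
    obtain ⟨ω, hω, hωa⟩ := exists_positive_functional_of_not_nonneg ha hna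
    exact hωa (h (ω ∘ₗ P.toNonUnitalSubalgebra.toSubmodule.subtype) fun b => hω b)
end

section
/- Let A be a (possibly non-unital) C*-algebra, P its Pedersen ideal, and (H, π) a *-representation of the *-algebra P on a complex inner product space H (not assumed complete). Then there exists a map Π from A to the bounded linear operators on the Hilbert-space completion H̄ of H which is ℂ-linear, multiplicative and star-preserving (Π(star a) is the adjoint of Π(a)), such that Π(p)(x) = π(p)(x) for every p ∈ P and x ∈ H (under the canonical isometric embedding of H into H̄), and moreover ‖Π(a)‖ ≤ ‖a‖ for all a ∈ A. -/
open scoped ComplexInnerProductSpace ComplexOrder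

/-- For self-adjoint `h` with `‖h‖ ≤ m ^ 2`, the element `d = m - √(m ^ 2 - h)` lies in the
two-sided ideal generated by `h` and satisfies `(m - d) ^ 2 = m ^ 2 - h`. -/
theorem IsSelfAdjoint.exists_sq_completion {A : Type*} [NonUnitalCStarAlgebra A] {h : A}
    (hh : IsSelfAdjoint h) {m : ℝ} (hm : 0 < m) (hle : ‖h‖ ≤ m ^ 2) :
    ∃ d e : A, IsSelfAdjoint d ∧ d = h * e + (1 / (2 * m)) • h ∧ h = (2 * m) • d - d * d := by
  have hpos (t : ℝ) : 0 < m + √(m ^ 2 - t) := by positivity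
  have hsqrt : √(m ^ 2 - 0) = m := by rw [sub_zero, Real.sqrt_sq hm.le]
  set f : ℝ → ℝ := fun t ↦ m - √(m ^ 2 - t) with hf
  set k : ℝ → ℝ := fun t ↦ 1 / (m + √(m ^ 2 - t)) - 1 / (2 * m) with hk
  have hfc : Continuous f := by fun_prop
  have hkc : Continuous k :=
    (continuous_const.div (by fun_prop) fun t ↦ (hpos t).ne').sub continuous_const
  have hf0 : f 0 = 0 := by simp only [hf, hsqrt, sub_self]
  have hk0 : k 0 = 0 := by simp only [hk, hsqrt]; ring
  have hsq {t : ℝ} (ht : t ∈ quasispectrum ℝ h) : √(m ^ 2 - t) ^ 2 = m ^ 2 - t := by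
    refine Real.sq_sqrt (sub_nonneg.2 ?_)
    exact (le_abs_self t).trans
      ((NonUnitalIsometricContinuousFunctionalCalculus.norm_quasispectrum_le h ht hh).trans hle)
  refine ⟨cfcₙ f h, cfcₙ k h, cfcₙ_predicate f h, ?_, ?_⟩
  · calc cfcₙ f h = cfcₙ (fun t ↦ t * k t + 1 / (2 * m) * t) h := by
          refine cfcₙ_congr fun t ht ↦ ?_
          have h1 := hsq ht
          have h2 := (hpos t).ne'
          simp only [hf, hk]
          field_simp
          linear_combination (-2 * m) * h1
      _ = h * cfcₙ k h + (1 / (2 * m)) • h := by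
          rw [cfcₙ_add .., cfcₙ_mul .., cfcₙ_id' ℝ h, cfcₙ_const_mul_id ..]
  · calc h = cfcₙ (fun t : ℝ ↦ t) h := (cfcₙ_id' ℝ h).symm
      _ = cfcₙ (fun t ↦ 2 * m * f t - f t * f t) h := by
          refine cfcₙ_congr fun t ht ↦ ?_
          simp only [hf]
          linear_combination hsq ht
      _ = (2 * m) • cfcₙ f h - cfcₙ f h * cfcₙ f h := by
          rw [cfcₙ_sub (fun t ↦ 2 * m * f t) (fun t ↦ f t * f t) h
            (by fun_prop) (by rw [hf0, mul_zero]) (by fun_prop) (by rw [hf0, mul_zero]),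
            cfcₙ_mul f f h hfc.continuousOn hf0 hfc.continuousOn hf0,
            cfcₙ_const_mul (2 * m) f h hfc.continuousOn hf0]

namespace StarRep

variable {A : Type}

section Algebraic

variable [NonUnitalRing A] [Module ℂ A] [Star A] (R : StarRep A)

theorem norm_apply_sq (a : A) (x : R.carrier) :
    ((‖R.toFun a x‖ ^ 2 : ℝ) : ℂ) = ⟪x, R.toFun (star a * a) x⟫ := by
  rw [R.map_mul', LinearMap.comp_apply, ← R.star_rep']
  simp [inner_self_eq_norm_sq_to_K]

/-- If `star a * a = 2 m d - d ^ 2` with `d` self-adjoint, then `m ^ 2 - π (star a * a)` is the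
square of the symmetric operator `m - π d`, which bounds `π a` by `m`. -/
theorem norm_apply_le_of_sq_completion {a d : A} {m : ℝ} (hm : 0 ≤ m) (hd : star d = d)
    (h : star a * a + d * d = ((2 * m : ℝ) : ℂ) • d) (x : R.carrier) :
    ‖R.toFun a x‖ ≤ m * ‖x‖ := by
  have hdd := R.norm_apply_sq d x
  have ha := R.norm_apply_sq a x
  have hsum : ⟪x, R.toFun (star a * a + d * d) x⟫ = ⟪x, R.toFun (((2 * m : ℝ) : ℂ) • d) x⟫ := by
    rw [h]
  rw [R.map_add', R.map_smul', LinearMap.add_apply, LinearMap.smul_apply, inner_add_right,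
    inner_smul_right, ← ha] at hsum
  rw [hd] at hdd
  rw [← hdd] at hsum
  have hre := congrArg RCLike.re hsum
  have hexp := norm_sub_sq (𝕜 := ℂ) ((m : ℂ) • x) (R.toFun d x)
  rw [inner_smul_left, norm_smul] at hexp
  simp only [← Complex.ofReal_add, Complex.conj_ofReal, RCLike.re_to_complex, Complex.ofReal_re,
    Complex.re_ofReal_mul, Complex.norm_real, Real.norm_of_nonneg hm] at hre hexp
  refine abs_le_of_sq_le_sq' ?_ (by positivity) |>.2
  nlinarith [sq_nonneg ‖(m : ℂ) • x - R.toFun d x‖]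

end Algebraic

theorem norm_apply_le [NonUnitalCStarAlgebra A] {P : NonUnitalStarSubalgebra ℂ A}
    (hP : ∀ a ∈ P, ∀ b : A, a * b ∈ P ∧ b * a ∈ P) (R : StarRep P) (p : P) (x : R.carrier) :
    ‖R.toFun p x‖ ≤ ‖p‖ * ‖x‖ := by
  obtain rfl | hp := eq_or_ne p 0
  · have : R.toFun 0 = 0 := by simpa using R.map_smul' 0 0
    simp [this]
  have hle : ‖star (p : A) * p‖ ≤ ‖p‖ ^ 2 := by
    rw [CStarRing.norm_star_mul_self, sq]; rfl
  obtain ⟨d, e, hd, hde, h⟩ :=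
    (IsSelfAdjoint.star_mul_self (p : A)).exists_sq_completion (norm_pos_iff.2 hp) hle
  have hmem : star (p : A) * p ∈ P := (star p * p).2
  have hdP : d ∈ P := by
    rw [hde, ← Complex.coe_smul]
    exact add_mem (hP _ hmem e).1 (SMulMemClass.smul_mem _ hmem)
  refine R.norm_apply_le_of_sq_completion (d := ⟨d, hdP⟩) (norm_nonneg p) (Subtype.ext hd) ?_ x
  refine Subtype.ext ?_
  change star (p : A) * p + d * d = ((2 * ‖p‖ : ℝ) : ℂ) • d
  rw [Complex.coe_smul]
  nth_rewrite 1 [h]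
  exact sub_add_cancel _ _

section Completion

open UniformSpace

variable [NonUnitalNormedRing A] [NormedSpace ℂ A] [StarRing A] (R : StarRep A)

/-- The extension to the Hilbert space completion of a representation by operators `π a` with
`‖π a‖ ≤ ‖a‖`. -/
noncomputable def completionMap (a : A) : Completion R.carrier →L[ℂ] Completion R.carrier :=
  (Completion.toComplL.toLinearMap ∘ₗ R.toFun a).extendOfNorm
    (Completion.toComplL (𝕜 := ℂ) (E := R.carrier)).toLinearMap

theorem completionMap_coe
    (hR : ∀ (a : A) (x : R.carrier), ‖R.toFun a x‖ ≤ ‖a‖ * ‖x‖)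
    (a : A) (x : R.carrier) :
    R.completionMap a (x : Completion R.carrier) = (R.toFun a x : Completion R.carrier) :=
  LinearMap.extendOfNorm_eq (e := (Completion.toComplL (𝕜 := ℂ) (E := R.carrier)).toLinearMap)
    Completion.denseRange_coe ⟨‖a‖, fun x ↦ by simpa using hR a x⟩ x

theorem norm_completionMap_le
    (hR : ∀ (a : A) (x : R.carrier), ‖R.toFun a x‖ ≤ ‖a‖ * ‖x‖)
    (a : A) : ‖R.completionMap a‖ ≤ ‖a‖ :=
  LinearMap.opNorm_extendOfNorm_le
    (e := (Completion.toComplL (𝕜 := ℂ) (E := R.carrier)).toLinearMap)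
    Completion.denseRange_coe (norm_nonneg a) fun x ↦ by simpa using hR a x

theorem ext_on_coe {S T : Completion R.carrier →L[ℂ] Completion R.carrier}
    (h : ∀ x : R.carrier, S x = T x) : S = T :=
  ContinuousLinearMap.ext fun x ↦
    Completion.induction_on x (isClosed_eq S.continuous T.continuous) h

theorem completionMap_add
    (hR : ∀ (a : A) (x : R.carrier), ‖R.toFun a x‖ ≤ ‖a‖ * ‖x‖)
    (a b : A) :
    R.completionMap (a + b) = R.completionMap a + R.completionMap b :=
  R.ext_on_coe fun x ↦ by simp [R.completionMap_coe hR, R.map_add', Completion.coe_add]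

theorem completionMap_smul
    (hR : ∀ (a : A) (x : R.carrier), ‖R.toFun a x‖ ≤ ‖a‖ * ‖x‖)
    (c : ℂ) (a : A) :
    R.completionMap (c • a) = c • R.completionMap a :=
  R.ext_on_coe fun x ↦ by simp [R.completionMap_coe hR, R.map_smul', Completion.coe_smul]

theorem completionMap_mul
    (hR : ∀ (a : A) (x : R.carrier), ‖R.toFun a x‖ ≤ ‖a‖ * ‖x‖)
    (a b : A) :
    R.completionMap (a * b) = (R.completionMap a).comp (R.completionMap b) :=
  R.ext_on_coe fun x ↦ by simp [R.completionMap_coe hR, R.map_mul']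

theorem completionMap_star
    (hR : ∀ (a : A) (x : R.carrier), ‖R.toFun a x‖ ≤ ‖a‖ * ‖x‖)
    (a : A) :
    R.completionMap (star a) = ContinuousLinearMap.adjoint (R.completionMap a) := by
  rw [ContinuousLinearMap.eq_adjoint_iff]
  intro x y
  induction x, y using Completion.induction_on₂ with
  | hp => exact isClosed_eq (by fun_prop) (by fun_prop)
  | ih x y =>
    rw [R.completionMap_coe hR, R.completionMap_coe hR, Completion.inner_coe,
      Completion.inner_coe, R.star_rep', star_star]

end Completion

end StarRep

open UniformSpace in
/-- Any *-representation of the Pedersen ideal `P` of a C*-algebra `A` on a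
complex pre-Hilbert space `H` extends to a *-representation `Π` of all of `A` by bounded
operators on the Hilbert space completion of `H`, with `‖T a‖ ≤ ‖a‖`. -/
theorem stmt1 {A : Type} [NonUnitalCStarAlgebra A]
    (P : NonUnitalStarSubalgebra ℂ A)
    (hPideal : ∀ a ∈ P, ∀ b : A, a * b ∈ P ∧ b * a ∈ P)
    (hPdense : Dense (P : Set A))
    (hPmin : ∀ I : TwoSidedIdeal A, Dense (I : Set A) → (P : Set A) ⊆ (I : Set A))
    (R : StarRep P) :
    ∃ T : A → Completion R.carrier →L[ℂ] Completion R.carrier,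
      (∀ (c : ℂ) (a : A), T (c • a) = c • T a) ∧
      (∀ a b : A, T (a + b) = T a + T b) ∧
      (∀ a b : A, T (a * b) = (T a).comp (T b)) ∧
      (∀ a : A, T (star a) = ContinuousLinearMap.adjoint (T a)) ∧
      (∀ (p : P) (x : R.carrier), T (p : A) (x : Completion R.carrier) = (R.toFun p x : Completion R.carrier)) ∧
      (∀ a : A, ‖T a‖ ≤ ‖a‖) := by
  have hR := StarRep.norm_apply_le hPideal R
  let f : P →ₗ[ℂ] Completion R.carrier →L[ℂ] Completion R.carrier :=
    { toFun := R.completionMap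
      map_add' := R.completionMap_add hR
      map_smul' := R.completionMap_smul hR }
  let i : P →ₗ[ℂ] A := P.toNonUnitalSubalgebra.toSubmodule.subtype
  have hi : DenseRange i := hPdense.denseRange_val
  have hf (p : P) : ‖f p‖ ≤ 1 * ‖i p‖ :=
    (R.norm_completionMap_le hR p).trans_eq (one_mul _).symm
  obtain ⟨T, hT, hTle⟩ : ∃ T : A →L[ℂ] Completion R.carrier →L[ℂ] Completion R.carrier,
      (∀ p : P, T (p : A) = R.completionMap p) ∧ ∀ a, ‖T a‖ ≤ 1 * ‖a‖ :=
    ⟨f.extendOfNorm i, LinearMap.extendOfNorm_eq hi ⟨1, hf⟩,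
      LinearMap.norm_extendOfNorm_apply_le hi 1 hf⟩
  refine ⟨T, map_smul T, map_add T, fun a b ↦ ?_, fun a ↦ ?_, fun p x ↦ ?_, fun a ↦ ?_⟩
  · refine hi.induction_on₂ (p := fun a b ↦ T (a * b) = (T a).comp (T b)) ?_ (fun p q ↦ ?_) a b
    · exact isClosed_eq (by fun_prop) (by fun_prop)
    · exact (hT (p * q)).trans ((R.completionMap_mul hR p q).trans
        (congrArg₂ _ (hT p) (hT q)).symm)
  · refine hi.induction_on (p := fun a ↦ T (star a) = ContinuousLinearMap.adjoint (T a)) a ?_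
      fun p ↦ ?_
    · exact isClosed_eq (by fun_prop)
        (ContinuousLinearMap.adjoint.continuous.comp T.continuous)
    · exact (hT (star p)).trans ((R.completionMap_star hR p).trans
        (congrArg _ (hT p)).symm)
  · rw [hT, R.completionMap_coe hR]
  · exact (hTle a).trans_eq (one_mul _)
end

section
/- Let A be a (possibly non-unital) C*-algebra, P its Pedersen ideal, and X a right P-module (action additive in both variables, ℂ-bilinear, and associative: x·(p q) = (x·p)·q) equipped with a map ⟨·,·⟩ : X × X → P that is ℂ-linear and P-linear in the second variable (⟨x, y·p⟩ = ⟨x,y⟩ * p), satisfies ⟨x,y⟩ = star ⟨y,x⟩, and is positive semi-definite in the sense that 0 ≤ ⟨x,x⟩ as an element of the C*-algebra A for every x ∈ X. Then for every *-representation (H, π) of the *-algebra P, every n, all x_1, …, x_n ∈ X and all φ_1, …, φ_n ∈ H, the sum Σ_{i,j} ⟪φ_i, π(⟨x_i, x_j⟩) φ_j⟫ is a nonnegative real number (i.e. the bimodule X satisfies property P). -/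
open scoped ComplexInnerProductSpace ComplexOrder

/-- A positive element `c` of a C⋆-algebra is of the form `(δ + b)² - δ²` with `b` self-adjoint,
and `b²` lies in the right ideal generated by `c`. -/
theorem exists_eq_two_smul_add_mul_self {A : Type*} [NonUnitalCStarAlgebra A] [PartialOrder A]
    [StarOrderedRing A] {c : A} (hc : 0 ≤ c) {δ : ℝ} (hδ : 0 < δ) :
    ∃ b k : A, IsSelfAdjoint b ∧ c = ((2 * δ : ℝ) : ℂ) • b + b * b ∧ b * b = c * k := by
  have hpos : ∀ t ∈ quasispectrum ℝ c, 0 ≤ t := quasispectrum_nonneg_of_nonneg c hc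
  have hden : ∀ t : ℝ, 0 < √(t + δ ^ 2) + δ := fun t ↦ by positivity
  let f : ℝ → ℝ := fun t ↦ √(t + δ ^ 2) - δ
  let g : ℝ → ℝ := fun t ↦ t / (√(t + δ ^ 2) + δ) ^ 2
  have hf : Continuous f := by fun_prop
  have hg : Continuous g :=
    Continuous.div (by fun_prop) (by fun_prop) fun t ↦ (pow_pos (hden t) 2).ne'
  have hf0 : f 0 = 0 := by simp [f, Real.sqrt_sq hδ.le]
  have hg0 : g 0 = 0 := by simp [g]
  refine ⟨cfcₙ f c, cfcₙ g c, cfcₙ_predicate f c, ?_, ?_⟩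
  · rw [Complex.coe_smul, ← cfcₙ_mul f f c, ← cfcₙ_const_mul (2 * δ) f c, ← cfcₙ_add _ _ c]
    conv_lhs => rw [← cfcₙ_id' ℝ c]
    refine cfcₙ_congr fun t ht ↦ ?_
    have := Real.sq_sqrt (add_nonneg (hpos t ht) (sq_nonneg δ))
    simp only [f]
    linear_combination -this
  · conv_rhs => enter [1]; rw [← cfcₙ_id' ℝ c]
    rw [← cfcₙ_mul f f c, ← cfcₙ_mul _ g c]
    refine cfcₙ_congr fun t ht ↦ ?_
    have := Real.sq_sqrt (add_nonneg (hpos t ht) (sq_nonneg δ))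
    simp only [f, g]
    rw [← mul_div_assoc, eq_div_iff (pow_ne_zero 2 (hden t).ne')]
    have h : (√(t + δ ^ 2) - δ) * (√(t + δ ^ 2) + δ) = t := by linear_combination this
    linear_combination ((√(t + δ ^ 2) - δ) * (√(t + δ ^ 2) + δ) + t) * h

/-- Compressing a self-adjoint element `a` of a C⋆-algebra to its negative part, by an element
of the right ideal generated by `a`, yields a negative element which detects whether `0 ≤ a`. -/
theorem IsSelfAdjoint.exists_star_mul_mul_eq_neg {A : Type*} [NonUnitalCStarAlgebra A]
    [PartialOrder A] [StarOrderedRing A] {a : A} (ha : IsSelfAdjoint a) :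
    ∃ k t : A, star (a * k) * a * (a * k) = -(star t * t) ∧ (t = 0 → 0 ≤ a) := by
  let k := cfcₙ (fun s : ℝ ↦ √(s⁻)) a
  have hk : star k = k := (cfcₙ_predicate _ a : IsSelfAdjoint k)
  have hn : star (a⁻) = a⁻ := (cfcₙ_predicate _ a : IsSelfAdjoint (a⁻))
  have hid : cfcₙ (fun s : ℝ ↦ s) a = a := cfcₙ_id' ℝ a
  refine ⟨k, a⁻ * a⁻, ?_, fun h ↦ ?_⟩
  · calc star (a * k) * a * (a * k)
        = k * cfcₙ (fun s : ℝ ↦ s) a * cfcₙ (fun s : ℝ ↦ s) a * (cfcₙ (fun s : ℝ ↦ s) a * k) := by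
          rw [hid, star_mul, hk, ha.star_eq]
      _ = -(a⁻ * a⁻ * (a⁻ * a⁻)) := by
          simp only [k, CFC.negPart_def]
          rw [← cfcₙ_mul _ _ a, ← cfcₙ_mul _ _ a, ← cfcₙ_mul _ _ a, ← cfcₙ_mul _ _ a,
            ← cfcₙ_mul _ _ a, ← cfcₙ_mul _ _ a, ← cfcₙ_neg]
          refine cfcₙ_congr fun s _ ↦ ?_
          have h1 := Real.mul_self_sqrt (negPart_nonneg s)
          rcases le_total 0 s with hs | hs
          · simp [negPart_eq_zero.2 hs]
          · have h2 : s⁻ = -s := negPart_eq_neg.2 hs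
            simp only [h2] at h1 ⊢
            linear_combination s ^ 3 * h1
      _ = -(star (a⁻ * a⁻) * (a⁻ * a⁻)) := by rw [star_mul, hn]
  · rw [← CFC.negPart_eq_zero_iff a ha, ← CStarRing.star_mul_self_eq_zero_iff, hn, h]

theorem CStarMatrix.nonneg_of_diag_nonneg {A n : Type*} [NonUnitalCStarAlgebra A]
    [PartialOrder A] [StarOrderedRing A] [Fintype n] {G : CStarMatrix n n A}
    (hG : IsSelfAdjoint G)
    (h : ∀ (K : CStarMatrix n n A) (k : n), 0 ≤ (star (G * K) * G * (G * K)) k k) :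
    0 ≤ G := by
  obtain ⟨K, T, hKT, hT⟩ := hG.exists_star_mul_mul_eq_neg
  refine hT (CStarMatrix.ext fun i k ↦ ?_)
  have h1 := h K k
  rw [hKT, CStarMatrix.neg_apply, neg_nonneg, CStarMatrix.mul_apply] at h1
  have h2 : ∀ j ∈ Finset.univ, 0 ≤ star T k j * T j k := fun j _ ↦ star_mul_self_nonneg (T j k)
  exact (CStarRing.star_mul_self_eq_zero_iff _).1 <| (Finset.sum_eq_zero_iff_of_nonneg h2).1
    (le_antisymm h1 (Finset.sum_nonneg h2)) i (Finset.mem_univ i)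

namespace StarRep

variable {A : Type} [NonUnitalRing A] [Module ℂ A] [Star A] (R : StarRep A)

theorem map_sum {ι : Type*} (s : Finset ι) (a : ι → A) :
    R.toFun (∑ i ∈ s, a i) = ∑ i ∈ s, R.toFun (a i) :=
  _root_.map_sum (AddMonoidHom.mk' R.toFun R.map_add') a s

/-- If `G = (δ + b)² - δ²` for a self-adjoint matrix `b`, then the form defined by `G` is bounded
below by `-δ²`. -/
theorem neg_sq_mul_le_sum_inner {n : Type*} [Fintype n] {G b : n → n → A} {δ : ℝ}
    (hb : ∀ i j, star (b i j) = b j i)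
    (hG : ∀ i j, G i j = ((2 * δ : ℝ) : ℂ) • b i j + ∑ k, b i k * b k j) (φ : n → R.carrier) :
    ((-(δ ^ 2 * ∑ i, ‖φ i‖ ^ 2) : ℝ) : ℂ) ≤ ∑ i, ∑ j, ⟪φ i, R.toFun (G i j) (φ j)⟫ := by
  let ψ : n → R.carrier := fun k ↦ ∑ j, R.toFun (b k j) (φ j)
  have hψ : ∑ i, ∑ j, ⟪φ i, R.toFun (∑ k, b i k * b k j) (φ j)⟫ = ∑ k, ⟪ψ k, ψ k⟫ := by
    have h1 : ∀ i, ∑ j, ⟪φ i, R.toFun (∑ k, b i k * b k j) (φ j)⟫ =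
        ∑ k, ⟪φ i, R.toFun (b i k) (ψ k)⟫ := fun i ↦ by
      simp only [ψ, R.map_sum, LinearMap.sum_apply, inner_sum, _root_.map_sum, R.map_mul',
        LinearMap.comp_apply]
      exact Finset.sum_comm
    have h2 : ∀ k, ⟪ψ k, ψ k⟫ = ∑ i, ⟪φ i, R.toFun (b i k) (ψ k)⟫ := fun k ↦ by
      conv_lhs => enter [2]; simp only [ψ]
      simp only [sum_inner, R.star_rep', hb]
    simp only [h1, h2]
    exact Finset.sum_comm
  have hswap : ∑ i, ⟪φ i, ψ i⟫ = ∑ i, ⟪ψ i, φ i⟫ := by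
    simp only [ψ, inner_sum, sum_inner, R.star_rep', hb]
    exact Finset.sum_comm
  have key : ∑ i, ∑ j, ⟪φ i, R.toFun (G i j) (φ j)⟫ =
      ∑ k, ⟪(δ : ℂ) • φ k + ψ k, (δ : ℂ) • φ k + ψ k⟫ - (δ : ℂ) ^ 2 * ∑ k, ⟪φ k, φ k⟫ := by
    have h1 : ∑ i, ∑ j, ⟪φ i, R.toFun (G i j) (φ j)⟫ =
        2 * δ * ∑ i, ⟪φ i, ψ i⟫ + ∑ k, ⟪ψ k, ψ k⟫ := by
      rw [← hψ]
      simp only [hG, R.map_add', R.map_smul', LinearMap.add_apply, LinearMap.smul_apply,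
        inner_add_right, inner_smul_right, Finset.sum_add_distrib, ψ, inner_sum, Finset.mul_sum]
      push_cast
      rfl
    rw [h1]
    simp only [inner_add_left, inner_add_right, inner_smul_left, inner_smul_right,
      Complex.conj_ofReal, Finset.sum_add_distrib, ← Finset.mul_sum]
    rw [← hswap]
    ring
  have hsum : ∀ v : n → R.carrier, ∑ k, ⟪v k, v k⟫ = ((∑ k, ‖v k‖ ^ 2 : ℝ) : ℂ) := fun v ↦ by
    push_cast
    exact Finset.sum_congr rfl fun k _ ↦ inner_self_eq_norm_sq_to_K (v k)
  rw [key, hsum, hsum, ← Complex.ofReal_pow, ← Complex.ofReal_mul, ← Complex.ofReal_sub,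
    Complex.real_le_real]
  have : 0 ≤ ∑ k, ‖(δ : ℂ) • φ k + ψ k‖ ^ 2 := by positivity
  linarith

/-- The form defined by a positive matrix with entries in a two-sided ideal `P` of a C⋆-algebra is
positive in every representation of `P`. -/
theorem sum_inner_nonneg {A n : Type} [NonUnitalCStarAlgebra A] [PartialOrder A]
    [StarOrderedRing A] [Fintype n] {P : NonUnitalStarSubalgebra ℂ A}
    (hP : ∀ a ∈ P, ∀ b : A, a * b ∈ P) (R : StarRep P) {G : n → n → P}
    (hG : (0 : CStarMatrix n n A) ≤ CStarMatrix.ofMatrix fun i j ↦ (G i j : A))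
    (φ : n → R.carrier) :
    0 ≤ ∑ i, ∑ j, ⟪φ i, R.toFun (G i j) (φ j)⟫ := by
  set S := ∑ i, ∑ j, ⟪φ i, R.toFun (G i j) (φ j)⟫
  have bound : ∀ δ : ℝ, 0 < δ → ((-(δ ^ 2 * ∑ i, ‖φ i‖ ^ 2) : ℝ) : ℂ) ≤ S := by
    intro δ hδ
    obtain ⟨b, k, hb, hGb, hbk⟩ := exists_eq_two_smul_add_mul_self hG hδ
    have hb2 : ∀ i j, (b * b) i j ∈ P := fun i j ↦ by
      rw [hbk, CStarMatrix.mul_apply]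
      exact sum_mem fun l _ ↦ hP _ (G i l).2 _
    have hGb' : ∀ i j, (G i j : A) = ((2 * δ : ℝ) : ℂ) • b i j + (b * b) i j := fun i j ↦
      congrArg (fun M : CStarMatrix n n A ↦ M i j) hGb
    have hbP : ∀ i j, b i j ∈ P := fun i j ↦ by
      have hδ' : ((2 * δ : ℝ) : ℂ) ≠ 0 := by exact_mod_cast (by positivity : 2 * δ ≠ 0)
      rw [← inv_smul_smul₀ hδ' (b i j), ← sub_eq_iff_eq_add.2 (hGb' i j)]
      exact SMulMemClass.smul_mem _ (sub_mem (G i j).2 (hb2 i j))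
    refine R.neg_sq_mul_le_sum_inner (b := fun i j ↦ ⟨b i j, hbP i j⟩) (fun i j ↦ ?_)
      (fun i j ↦ ?_) φ
    · exact Subtype.ext (congrArg (fun M : CStarMatrix n n A ↦ M j i) hb.star_eq)
    · refine Subtype.ext ?_
      simp [hGb' i j, CStarMatrix.mul_apply]
  have him : S.im = 0 := by
    rw [← (Complex.le_def.1 (bound 1 one_pos)).2, Complex.ofReal_im]
  refine Complex.le_def.2 ⟨?_, him.symm⟩
  have hlim : Filter.Tendsto (fun δ : ℝ ↦ -(δ ^ 2 * ∑ i, ‖φ i‖ ^ 2)) (nhdsWithin 0 (Set.Ioi 0))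
      (nhds 0) := by
    refine tendsto_nhdsWithin_of_tendsto_nhds ?_
    exact Continuous.tendsto' (by fun_prop) _ _ (by simp)
  refine le_of_tendsto hlim ?_
  filter_upwards [self_mem_nhdsWithin] with δ hδ
  exact (Complex.ofReal_re _).symm.trans_le (Complex.le_def.1 (bound δ hδ)).1

end StarRep

/-- Let `P` be the Pedersen ideal of a C*-algebra `A`, `B` an arbitrary
*-algebra over `ℂ`, and `X` a `(B,P)`-bimodule with a positive semi-definite `P`-valued inner
product (positivity taken in the canonical order of `A`) and compatible `B`-action.  Then `X`
satisfies property P: for every *-representation `(H, π)` of `P`, the Hermitian form induced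
on `X ⊗ H` is positive semi-definite. -/
theorem stmt2 {A : Type} [NonUnitalCStarAlgebra A] [PartialOrder A] [StarOrderedRing A]
    (P : NonUnitalStarSubalgebra ℂ A)
    (hPideal : ∀ a ∈ P, ∀ b : A, a * b ∈ P ∧ b * a ∈ P)
    (hPdense : Dense (P : Set A))
    (hPmin : ∀ I : TwoSidedIdeal A, Dense (I : Set A) → (P : Set A) ⊆ (I : Set A))
    -- an arbitrary *-algebra `B` over `ℂ`:
    (B : Type) [NonUnitalRing B] [Module ℂ B] [SMulCommClass ℂ B B] [IsScalarTower ℂ B B]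
    [StarRing B] [StarModule ℂ B]
    -- a `(B,P)`-bimodule `X`:
    (X : Type) [AddCommGroup X] [Module ℂ X]
    (rsmul : X → P → X)
    (rsmul_add : ∀ (x y : X) (p : P), rsmul (x + y) p = rsmul x p + rsmul y p)
    (add_rsmul : ∀ (x : X) (p q : P), rsmul x (p + q) = rsmul x p + rsmul x q)
    (rsmul_smul : ∀ (c : ℂ) (x : X) (p : P), rsmul (c • x) p = c • rsmul x p)
    (smul_rsmul : ∀ (c : ℂ) (x : X) (p : P), rsmul x (c • p) = c • rsmul x p)
    (rsmul_mul : ∀ (x : X) (p q : P), rsmul x (p * q) = rsmul (rsmul x p) q)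
    (lsmul : B → X → X)
    (lsmul_add : ∀ (b : B) (x y : X), lsmul b (x + y) = lsmul b x + lsmul b y)
    (add_lsmul : ∀ (b b' : B) (x : X), lsmul (b + b') x = lsmul b x + lsmul b' x)
    (lsmul_smul : ∀ (c : ℂ) (b : B) (x : X), lsmul (c • b) x = c • lsmul b x)
    (smul_lsmul : ∀ (c : ℂ) (b : B) (x : X), lsmul b (c • x) = c • lsmul b x)
    (lsmul_mul : ∀ (b b' : B) (x : X), lsmul (b * b') x = lsmul b (lsmul b' x))
    (lsmul_rsmul : ∀ (b : B) (x : X) (p : P), rsmul (lsmul b x) p = lsmul b (rsmul x p))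
    -- a positive semi-definite `P`-valued inner product on `X`:
    (ip : X → X → P)
    (ip_add : ∀ x y z : X, ip x (y + z) = ip x y + ip x z)
    (ip_smul : ∀ (c : ℂ) (x y : X), ip x (c • y) = c • ip x y)
    (ip_rsmul : ∀ (x y : X) (p : P), ip x (rsmul y p) = ip x y * p)
    (ip_star : ∀ x y : X, ip x y = star (ip y x))
    (ip_pos : ∀ x : X, 0 ≤ (ip x x : A))
    -- compatible `B`-action:
    (ip_compat : ∀ (b : B) (x y : X), ip (lsmul b x) y = ip x (lsmul (star b) y)) :
    -- property P:
    ∀ (R : StarRep P) (n : ℕ) (x : Fin n → X) (φ : Fin n → R.carrier),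
      0 ≤ ∑ i, ∑ j, ⟪φ i, R.toFun (ip (x i) (x j)) (φ j)⟫ := by
  intro R n x φ
  let G : CStarMatrix (Fin n) (Fin n) A := CStarMatrix.ofMatrix fun i j ↦ (ip (x i) (x j) : A)
  refine R.sum_inner_nonneg (fun a ha b ↦ (hPideal a ha b).1) (G := fun i j ↦ ip (x i) (x j))
    (CStarMatrix.nonneg_of_diag_nonneg (G := G) ?_ fun K k ↦ ?_) φ
  · refine CStarMatrix.ext fun i j ↦ ?_
    exact congrArg Subtype.val (ip_star (x i) (x j)).symm
  · have hp : ∀ i, (G * K) i k ∈ P := fun i ↦ by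
      rw [CStarMatrix.mul_apply]
      exact sum_mem fun j _ ↦ (hPideal _ (ip (x i) (x j)).2 _).1
    have ip_sum : ∀ (y : X) (z : Fin n → X), ip y (∑ i, z i) = ∑ i, ip y (z i) := fun y z ↦
      map_sum (AddMonoidHom.mk' (ip y) (ip_add y)) z Finset.univ
    have sum_ip : ∀ (y : X) (z : Fin n → X), ip (∑ i, z i) y = ∑ i, ip (z i) y := fun y z ↦ by
      rw [ip_star, ip_sum, star_sum]
      exact Finset.sum_congr rfl fun i _ ↦ (ip_star _ _).symm
    have rsmul_ip : ∀ (y z : X) (p : P), ip (rsmul y p) z = star p * ip y z := fun y z p ↦ by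
      rw [ip_star, ip_rsmul, star_mul, ← ip_star]
    convert ip_pos (∑ i, rsmul (x i) ⟨(G * K) i k, hp i⟩) using 1
    simp only [ip_sum, sum_ip, ip_rsmul, rsmul_ip]
    rw [CStarMatrix.mul_apply]
    simp only [CStarMatrix.mul_apply (M := star (G * K)), Finset.sum_mul]
    push_cast
    rfl
end

section
/- Let A be a (possibly non-unital) C*-algebra and I a two-sided ideal of A closed under the involution. Then I is norm-closed if and only if I is the kernel of some *-representation of A on a complex inner product space (not assumed complete). -/
open scoped ComplexInnerProductSpace ComplexOrder

namespace TwoSidedIdeal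

variable {A : Type*} [NonUnitalCStarAlgebra A] (I : TwoSidedIdeal A)

lemma exists_mem_norm_sub_mul_le {a : A} (ha : star a * a ∈ I) {ε : ℝ} (hε : 0 < ε) :
    ∃ e ∈ I, IsSelfAdjoint e ∧ ‖e‖ ≤ 1 ∧ ‖a - a * e‖ ≤ ε := by
  set h := star a * a with hh
  have hsa : IsSelfAdjoint h := .star_mul_self a
  have hδ : 0 < ε ^ 2 := by positivity
  set δ := ε ^ 2 with hδ_def
  have hpos (x : ℝ) : 0 < δ ^ 2 + x ^ 2 := by positivity
  have hne (x : ℝ) : δ ^ 2 + x ^ 2 ≠ 0 := (hpos x).ne'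
  let k : ℝ → ℝ := fun x ↦ x / (δ ^ 2 + x ^ 2)
  let g : ℝ → ℝ := fun x ↦ x * k x
  have hk : Continuous k := by fun_prop (disch := exact hne _)
  have hg : Continuous g := by fun_prop
  have hk0 : k 0 = 0 := by simp [k]
  have hg0 : g 0 = 0 := by simp [g]
  have hgh : cfcₙ g h = h * cfcₙ k h := by
    rw [cfcₙ_mul (fun x : ℝ ↦ x) k h, cfcₙ_id' ℝ h]
  have hge : IsSelfAdjoint (cfcₙ g h) := cfcₙ_predicate g h
  refine ⟨cfcₙ g h, hgh ▸ I.mul_mem_right _ _ ha, hge, ?_, ?_⟩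
  · refine norm_cfcₙ_le fun x _ ↦ ?_
    have : g x = x ^ 2 / (δ ^ 2 + x ^ 2) := by simp only [g, k]; ring
    rw [this, Real.norm_of_nonneg (by positivity), div_le_one (hpos x)]
    nlinarith [sq_nonneg δ]
  · have key : star (a - a * cfcₙ g h) * (a - a * cfcₙ g h) =
        cfcₙ (fun x ↦ x - x * g x - (g x * x - g x * x * g x)) h := by
      rw [cfcₙ_sub (fun x ↦ x - x * g x) (fun x ↦ g x * x - g x * x * g x) h,
        cfcₙ_sub (fun x ↦ x) (fun x ↦ x * g x) h,
        cfcₙ_sub (fun x ↦ g x * x) (fun x ↦ g x * x * g x) h,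
        cfcₙ_mul (fun x ↦ g x * x) g h, cfcₙ_mul (fun x ↦ x) g h,
        cfcₙ_mul g (fun x ↦ x) h, cfcₙ_id' ℝ h]
      rw [star_sub, star_mul, hge.star_eq]
      simp only [hh, sub_mul, mul_sub, mul_assoc]
      abel
    have hle : ‖a - a * cfcₙ g h‖ ^ 2 ≤ ε ^ 2 := by
      rw [sq, ← CStarRing.norm_star_mul_self, key, ← hδ_def]
      refine norm_cfcₙ_le fun x _ ↦ ?_
      have : x - x * g x - (g x * x - g x * x * g x) = x * δ ^ 4 / (δ ^ 2 + x ^ 2) ^ 2 := by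
        simp only [g, k]
        field_simp [hne x]
        ring
      rw [this, Real.norm_eq_abs, abs_div, abs_mul, abs_of_pos (pow_pos (hpos x) 2),
        abs_of_pos (pow_pos hδ 4), div_le_iff₀ (pow_pos (hpos x) 2)]
      have h1 : |x| * δ ≤ δ ^ 2 + x ^ 2 := by
        rw [← sq_abs x]; nlinarith [sq_nonneg (|x| - δ), sq_nonneg δ, sq_nonneg |x|]
      have h2 : δ ^ 2 ≤ δ ^ 2 + x ^ 2 := by nlinarith [sq_nonneg x]
      calc |x| * δ ^ 4 = δ * ((|x| * δ) * δ ^ 2) := by ring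
        _ ≤ δ * ((δ ^ 2 + x ^ 2) * (δ ^ 2 + x ^ 2)) := by gcongr
        _ = δ * (δ ^ 2 + x ^ 2) ^ 2 := by ring
    exact (sq_le_sq₀ (norm_nonneg _) hε.le).mp hle

variable {I}

lemma smul_mem_of_star_mul_self_mem (hI : IsClosed (I : Set A)) {a : A} (ha : star a * a ∈ I)
    (c : ℂ) : c • a ∈ I := by
  rw [← SetLike.mem_coe, ← hI.closure_eq, Metric.mem_closure_iff]
  intro ε hε
  obtain ⟨e, heI, -, -, he⟩ := I.exists_mem_norm_sub_mul_le ha (ε := ε / (‖c‖ + 1)) (by positivity)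
  refine ⟨c • (a * e), mul_smul_comm c a e ▸ ?_, ?_⟩
  · rw [mul_smul_comm, ← smul_mul_assoc]
    exact I.mul_mem_left _ _ heI
  · rw [dist_eq_norm, ← smul_sub, norm_smul]
    calc ‖c‖ * ‖a - a * e‖ ≤ ‖c‖ * (ε / (‖c‖ + 1)) := by gcongr
      _ < (‖c‖ + 1) * (ε / (‖c‖ + 1)) := by gcongr; linarith
      _ = ε := by field_simp

lemma smul_mem_of_isClosed (hI : IsClosed (I : Set A)) {a : A} (ha : a ∈ I) (c : ℂ) : c • a ∈ I :=
  smul_mem_of_star_mul_self_mem hI (I.mul_mem_left _ _ ha) c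

lemma star_mul_self_mem_iff (hI : IsClosed (I : Set A)) {a : A} : star a * a ∈ I ↔ a ∈ I :=
  ⟨fun h ↦ by simpa using smul_mem_of_star_mul_self_mem hI h 1, I.mul_mem_left _ _⟩

variable [PartialOrder A] [StarOrderedRing A]

lemma exists_mem_norm_sub_le {c p i : A} (hc : 0 ≤ c) (hp : 0 ≤ p) (hi : i ∈ I) {δ : ℝ}
    (hδ : 0 < δ) (h : ‖c + p + i‖ ≤ δ) : ∃ j ∈ I, ‖c - j‖ ≤ 6 * δ := by
  obtain ⟨e, heI, hsa, he, hie⟩ := I.exists_mem_norm_sub_mul_le (I.mul_mem_left (star i) i hi) hδ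
  let T : A → A := fun z ↦ (z - z * e) - e * (z - z * e)
  have hT_norm (z : A) : ‖T z‖ ≤ 2 * ‖z - z * e‖ := by
    have h1 := norm_sub_le (z - z * e) (e * (z - z * e))
    have h2 := norm_mul_le e (z - z * e)
    have h3 := mul_le_mul_of_nonneg_right he (norm_nonneg (z - z * e))
    simp only [T]
    linarith
  have hT_nonneg (z : A) (hz : 0 ≤ z) : 0 ≤ T z := by
    obtain ⟨q, rfl⟩ := CStarAlgebra.nonneg_iff_eq_star_mul_self.mp hz
    have : T (star q * q) = star (q - q * e) * (q - q * e) := by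
      simp only [T, star_sub, star_mul, hsa.star_eq, sub_mul, mul_sub, mul_assoc]
      abel
    exact this ▸ star_mul_self_nonneg _
  have hT_add (x y : A) : T (x + y) = T x + T y := by
    simp only [T, add_mul, mul_sub, mul_add]
    abel
  refine ⟨c * e + e * (c - c * e), I.add_mem (I.mul_mem_left _ _ heI) (I.mul_mem_right _ _ heI), ?_⟩
  have hcT : c - (c * e + e * (c - c * e)) = T c := by simp only [T]; abel
  have hle : T c ≤ T (c + p) := by
    rw [hT_add]
    exact le_add_of_nonneg_right (hT_nonneg p hp)
  have heq : T (c + p) = T (c + p + i) - T i := by rw [hT_add (c + p) i]; abel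
  have hy : ‖(c + p + i) - (c + p + i) * e‖ ≤ 2 * δ := by
    have h1 := norm_sub_le (c + p + i) ((c + p + i) * e)
    have h2 := norm_mul_le (c + p + i) e
    have h3 := mul_le_mul_of_nonneg_left he (norm_nonneg (c + p + i))
    linarith
  rw [hcT]
  calc ‖T c‖ ≤ ‖T (c + p)‖ := CStarAlgebra.norm_le_norm_of_nonneg_of_le (hT_nonneg c hc) hle
    _ ≤ ‖T (c + p + i)‖ + ‖T i‖ := heq ▸ norm_sub_le _ _
    _ ≤ 2 * (2 * δ) + 2 * δ := by
      gcongr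
      · exact (hT_norm _).trans (by gcongr)
      · exact (hT_norm _).trans (by gcongr)
    _ = 6 * δ := by ring

open Complex in
lemma exists_positiveLinearMap_ne_zero (hI : IsClosed (I : Set A)) (hstar : ∀ a ∈ I, star a ∈ I)
    {c : A} (hc : 0 ≤ c) (hcI : c ∉ I) : ∃ f : A →ₚ[ℂ] ℂ, (∀ i ∈ I, f i = 0) ∧ f c ≠ 0 := by
  have hsmulI {i : A} (hi : i ∈ I) (r : ℝ) : r • i ∈ I := by
    simpa using smul_mem_of_isClosed hI hi (r : ℂ)
  obtain ⟨ε, hε, hball⟩ : ∃ ε > 0, ∀ j ∈ I, ε ≤ ‖c - j‖ := by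
    rw [← SetLike.mem_coe, ← hI.closure_eq, Metric.mem_closure_iff] at hcI
    push Not at hcI
    simpa [dist_eq_norm] using hcI
  let K : Set A := {x | ∃ p i, 0 ≤ p ∧ i ∈ I ∧ x = p + i}
  have hK : Convex ℝ K := by
    rintro _ ⟨p, i, hp, hi, rfl⟩ _ ⟨q, j, hq, hj, rfl⟩ s t hs ht -
    refine ⟨s • p + t • q, s • i + t • j, add_nonneg (smul_nonneg hs hp) (smul_nonneg ht hq),
      I.add_mem (hsmulI hi s) (hsmulI hj t), ?_⟩
    simp only [smul_add]
    abel
  have hdisj : Disjoint (Metric.ball (-c) (ε / 7)) K := by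
    rw [Set.disjoint_left]
    rintro _ hx ⟨p, i, hp, hi, rfl⟩
    have hx' : ‖c + p + i‖ ≤ ε / 7 := by
      rw [Metric.mem_ball, dist_eq_norm, sub_neg_eq_add, add_comm (p + i), ← add_assoc] at hx
      exact hx.le
    obtain ⟨j, hj, hcj⟩ := exists_mem_norm_sub_le hc hp hi (by positivity) hx'
    linarith [hball j hj]
  obtain ⟨f, u, hfu, huf⟩ := RCLike.geometric_hahn_banach_open (𝕜 := ℂ)
    (convex_ball (-c) (ε / 7)) Metric.isOpen_ball hK hdisj
  simp only [RCLike.re_to_complex] at hfu huf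
  have hu : u ≤ 0 := by simpa using huf 0 ⟨0, 0, le_rfl, I.zero_mem, by simp⟩
  have hfc : 0 < (f c).re := by
    have := hfu (-c) (Metric.mem_ball_self (by positivity))
    simp only [map_neg, neg_re] at this
    linarith
  have hfK (x : A) (hx : ∀ r : ℝ, 0 ≤ r → r • x ∈ K) : 0 ≤ (f x).re := by
    by_contra! hneg
    have := huf _ (hx ((u - 1) / (f x).re) (div_nonneg_of_nonpos (by linarith) hneg.le))
    rw [← Complex.coe_smul, map_smul, smul_eq_mul, re_ofReal_mul, div_mul_cancel₀ _ hneg.ne] at this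
    linarith
  have hf_nonneg {p : A} (hp : 0 ≤ p) : 0 ≤ (f p).re :=
    hfK p fun r hr ↦ ⟨r • p, 0, smul_nonneg hr hp, I.zero_mem, by simp⟩
  have hf_re {i : A} (hi : i ∈ I) : (f i).re = 0 := by
    have h (j : A) (hj : j ∈ I) : 0 ≤ (f j).re :=
      hfK j fun r hr ↦ ⟨0, r • j, le_rfl, hsmulI hj r, by simp⟩
    have := h (-i) (I.neg_mem hi)
    simp only [map_neg, neg_re] at this
    linarith [h i hi]
  have hf_zero {i : A} (hi : i ∈ I) : f i = 0 := by
    have := hf_re (smul_mem_of_isClosed hI hi Complex.I)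
    exact Complex.ext (hf_re hi) (by simpa using this)
  let F : A →ₗ[ℂ] ℂ :=
    { toFun a := f a + star (f (star a))
      map_add' x y := by simp only [star_add, map_add]; ring
      map_smul' r x := by simp [mul_add] }
  have hF {p : A} (hp : 0 ≤ p) : F p = ((2 * (f p).re : ℝ) : ℂ) := by
    simp only [F, LinearMap.coe_mk, AddHom.coe_mk, (IsSelfAdjoint.of_nonneg hp).star_eq]
    exact Complex.add_conj _
  refine ⟨.mk₀ F fun p hp ↦ ?_, fun i hi ↦ ?_, ?_⟩
  · rw [hF hp, Complex.zero_le_real]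
    exact mul_nonneg zero_le_two (hf_nonneg hp)
  · change f i + star (f (star i)) = 0
    simp [hf_zero hi, hf_zero (hstar i hi)]
  · change F c ≠ 0
    rw [hF hc]
    exact_mod_cast (mul_pos two_pos hfc).ne'

end TwoSidedIdeal

namespace PositiveLinearMap

variable {A : Type*} [NonUnitalCStarAlgebra A] [PartialOrder A] [StarOrderedRing A] (f : A →ₚ[ℂ] ℂ)

lemma gnsNonUnitalStarAlgHom_apply_toPreGNS_eq_zero_iff {a b : A} :
    f.gnsNonUnitalStarAlgHom a (f.toPreGNS b : f.GNS) = 0 ↔ f (star (a * b) * (a * b)) = 0 := by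
  rw [gnsNonUnitalStarAlgHom_apply_coe, ← norm_eq_zero, UniformSpace.Completion.norm_coe,
    ← sq_eq_zero_iff, ← Complex.ofReal_eq_zero, Complex.ofReal_pow, preGNS_norm_sq]
  simp

lemma gnsNonUnitalStarAlgHom_eq_zero_iff {a : A} :
    f.gnsNonUnitalStarAlgHom a = 0 ↔ ∀ b, f (star (a * b) * (a * b)) = 0 := by
  simp_rw [← gnsNonUnitalStarAlgHom_apply_toPreGNS_eq_zero_iff]
  refine ⟨fun h b ↦ by simp [h], fun h ↦ ?_⟩
  ext x
  induction x using UniformSpace.Completion.induction_on with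
  | hp => exact isClosed_eq (by fun_prop) (by fun_prop)
  | ih x => exact h (f.ofPreGNS x)

end PositiveLinearMap

namespace StarRep

section HilbertSum

variable {A : Type} [NonUnitalCStarAlgebra A] {ι : Type} {H : ι → Type}
  [∀ i, NormedAddCommGroup (H i)] [∀ i, InnerProductSpace ℂ (H i)] [∀ i, CompleteSpace (H i)]

/-- The Hilbert sum of a family of representations of a C⋆-algebra on Hilbert spaces. -/
noncomputable def hilbertSum (π : ∀ i, A →⋆ₙₐ[ℂ] (H i →L[ℂ] H i)) : StarRep A where
  carrier := lp H 2
  toFun a :=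
    { toFun x := ⟨fun i ↦ π i a (x i), ((lp.memℓp x).norm.const_mul ‖a‖).mono fun i ↦
        ((π i a).le_opNorm _).trans <|
          mul_le_mul_of_nonneg_right (NonUnitalStarAlgHom.norm_apply_le (π i) a) (norm_nonneg _)⟩
      map_add' x y := lp.ext <| funext fun i ↦ map_add (π i a) (x i) (y i)
      map_smul' c x := lp.ext <| funext fun i ↦ map_smul (π i a) c (x i) }
  map_add' a b := LinearMap.ext fun x ↦ lp.ext <| funext fun i ↦
    DFunLike.congr_fun (map_add (π i) a b) (x i)
  map_smul' c a := by ext x i; simp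
  map_mul' a b := by ext x i; simp
  star_rep' a x y := by
    simp only [lp.inner_eq_tsum]
    refine tsum_congr fun i ↦ ?_
    change ⟪π i a (x i), y i⟫ = ⟪x i, π i (star a) (y i)⟫
    rw [map_star, ContinuousLinearMap.star_eq_adjoint, ContinuousLinearMap.adjoint_inner_right]

lemma hilbertSum_toFun_eq_zero_iff (π : ∀ i, A →⋆ₙₐ[ℂ] (H i →L[ℂ] H i)) {a : A} :
    (hilbertSum π).toFun a = 0 ↔ ∀ i, π i a = 0 := by
  classical
  refine ⟨fun h i ↦ ?_, fun h ↦ ?_⟩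
  · ext v
    have := congr_arg (fun z : lp H 2 ↦ z i) (LinearMap.congr_fun h (lp.single 2 i v))
    change π i a (lp.single 2 i v i) = 0 at this
    rwa [lp.single_apply_self] at this
  · refine LinearMap.ext fun x ↦ lp.ext <| funext fun i ↦ ?_
    change π i a (x.1 i) = 0
    simp [h i]

end HilbertSum

variable {A : Type} [NonUnitalCStarAlgebra A] [PartialOrder A] [StarOrderedRing A]

/-- The vector functional `a ↦ ⟪x, π(a) x⟫` of a representation `π`. -/
noncomputable def vectorFunctional (R : StarRep A) (x : R.carrier) : A →ₚ[ℂ] ℂ :=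
  .mk₀
    { toFun a := ⟪x, R.toFun a x⟫
      map_add' a b := by simp [R.map_add']
      map_smul' c a := by simp [R.map_smul'] } fun a ha ↦ by
    obtain ⟨b, rfl⟩ := CStarAlgebra.nonneg_iff_eq_star_mul_self.mp ha
    change 0 ≤ ⟪x, R.toFun (star b * b) x⟫
    rw [R.map_mul', LinearMap.comp_apply, ← R.star_rep']
    rw [inner_self_eq_norm_sq_to_K]
    rw [RCLike.ofReal_eq_complex_ofReal, ← Complex.ofReal_pow, Complex.zero_le_real]
    positivity

lemma isClosed_ker (R : StarRep A) : IsClosed {a : A | R.toFun a = 0} := by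
  have : {a : A | R.toFun a = 0} = ⋂ x, R.vectorFunctional x ⁻¹' {0} := by
    ext a
    simp only [Set.mem_ofPred_eq, Set.mem_iInter, Set.mem_preimage, Set.mem_singleton_iff]
    refine ⟨fun h x ↦ ?_, fun h ↦ (inner_map_self_eq_zero _).mp fun x ↦ ?_⟩
    · change ⟪x, R.toFun a x⟫ = 0
      simp [h]
    · exact inner_eq_zero_symm.mp (h x)
  rw [this]
  exact isClosed_iInter fun x ↦ isClosed_singleton.preimage (map_continuous (R.vectorFunctional x))

end StarRep

lemma TwoSidedIdeal.exists_starRep_ker_eq {A : Type} [NonUnitalCStarAlgebra A] [PartialOrder A]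
    [StarOrderedRing A] {I : TwoSidedIdeal A} (hI : IsClosed (I : Set A))
    (hstar : ∀ a ∈ I, star a ∈ I) : ∃ R : StarRep A, (I : Set A) = {a : A | R.toFun a = 0} := by
  refine ⟨.hilbertSum fun f : {f : A →ₚ[ℂ] ℂ // ∀ i ∈ I, f i = 0} ↦ f.1.gnsNonUnitalStarAlgHom, ?_⟩
  ext a
  simp only [SetLike.mem_coe, Set.mem_ofPred_eq, StarRep.hilbertSum_toFun_eq_zero_iff,
    PositiveLinearMap.gnsNonUnitalStarAlgHom_eq_zero_iff]
  refine ⟨fun ha f b ↦ f.2 _ (I.mul_mem_left _ _ (I.mul_mem_right _ _ ha)), fun h ↦ ?_⟩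
  by_contra ha
  have ha' : star (a * star a) * (a * star a) ∉ I := fun h ↦ ha <| by
    rw [star_mul_self_mem_iff hI] at h
    nth_rw 1 [← star_star a] at h
    rw [star_mul_self_mem_iff hI] at h
    simpa using hstar _ h
  obtain ⟨f, hfI, hf⟩ := exists_positiveLinearMap_ne_zero hI hstar (star_mul_self_nonneg _) ha'
  exact hf (h ⟨f, hfI⟩ (star a))

/-- Let `A` be a (possibly non-unital) C*-algebra and `I` a two-sided ideal
of `A` closed under the involution.  Then `I` is norm-closed if and only if `I` is the kernel
of some *-representation of `A` on a complex inner product space. -/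
theorem stmt6 {A : Type} [NonUnitalCStarAlgebra A]
    (I : TwoSidedIdeal A) (hstar : ∀ a ∈ I, star a ∈ I) :
    IsClosed (I : Set A) ↔ ∃ R : StarRep A, (I : Set A) = {a : A | R.toFun a = 0} := by
  let _ := CStarAlgebra.spectralOrder A
  have := CStarAlgebra.spectralOrderedRing A
  exact ⟨fun hI ↦ TwoSidedIdeal.exists_starRep_ker_eq hI hstar, fun ⟨R, hR⟩ ↦ hR ▸ R.isClosed_ker⟩
end
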